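/- arXiv:0907.3398 — 3 statements merged into one kernel-verified Lean document; each statement's English description precedes it below -/
import Mathlib

section
/- Let r₀, r₁ ∈ [0,1] with r₀ ≠ r₁, set x := √r₁ − √r₀, w := (r₀ + r₁ + 2)/2 − 2√(r₀r₁) − √((1−r₀)(1−r₁)), and N_th := 2 ln 2 / (2 − r₀ − r₁ − 2√((1−r₀)(1−r₁))). Then for every real N > N_th one has (1/2)·exp(−Nw) < (1 − √(1 − exp(−Nx²)))/2. -/
/-- Above the threshold energy N_th, the asymptotic Battacharyya bound exp(−Nw)/2
falls strictly below the classical discrimination bound (1 − √(1 − exp(−Nx²)))/2. -/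
theorem threshold_vs_classical (r₀ r₁ : ℝ) (h₀ : r₀ ∈ Set.Icc (0:ℝ) 1)
    (h₁ : r₁ ∈ Set.Icc (0:ℝ) 1) (hne : r₀ ≠ r₁) (N : ℝ)
    (hN : N > 2 * Real.log 2 / (2 - r₀ - r₁ - 2 * Real.sqrt ((1 - r₀) * (1 - r₁)))) :
    (1 / 2) * Real.exp (-(N * ((r₀ + r₁ + 2) / 2 - 2 * Real.sqrt (r₀ * r₁)
        - Real.sqrt ((1 - r₀) * (1 - r₁))))) <
      (1 - Real.sqrt (1 - Real.exp (-(N * (Real.sqrt r₁ - Real.sqrt r₀) ^ 2)))) / 2 := by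
  obtain ⟨a0, a1⟩ := h₀
  obtain ⟨b0, b1⟩ := h₁
  have ha : 0 ≤ 1 - r₀ := by linarith
  have hb : 0 ≤ 1 - r₁ := by linarith
  rw [Real.sqrt_mul ha] at *
  rw [Real.sqrt_mul a0]
  have e1 := Real.sq_sqrt ha
  have e2 := Real.sq_sqrt hb
  have e3 := Real.sq_sqrt a0
  have e4 := Real.sq_sqrt b0
  have hs : √(1 - r₀) - √(1 - r₁) ≠ 0 := by
    intro h
    have h' : √(1 - r₀) = √(1 - r₁) := by linarith
    rw [h'] at e1
    apply hne
    linarith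
  have hD : 0 < 2 - r₀ - r₁ - 2 * (√(1 - r₀) * √(1 - r₁)) := by
    have : 0 < (√(1 - r₀) - √(1 - r₁)) ^ 2 := by positivity
    nlinarith
  have hl : 0 < Real.log 2 := Real.log_pos (by norm_num)
  have hN0 : 0 < N := lt_trans (by positivity) hN
  have hM := (div_lt_iff₀ hD).1 hN
  have hle : Real.exp (-(N * (√r₁ - √r₀) ^ 2)) ≤ 1 := by
    rw [Real.exp_le_one_iff]
    have : 0 ≤ N * (√r₁ - √r₀) ^ 2 := by positivity
    linarith
  have hlt : Real.exp (-(N * ((r₀ + r₁ + 2) / 2 - 2 * (√r₀ * √r₁) - √(1 - r₀) * √(1 - r₁))))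
      < Real.exp (-(N * (√r₁ - √r₀) ^ 2)) / 2 := by
    have h2 : Real.exp (-(N * (√r₁ - √r₀) ^ 2)) / 2
        = Real.exp (-(N * (√r₁ - √r₀) ^ 2) - Real.log 2) := by
      rw [Real.exp_sub, Real.exp_log (by norm_num)]
    rw [h2, Real.exp_lt_exp]
    have h3 : (√r₁ - √r₀) ^ 2 = r₁ + r₀ - 2 * (√r₀ * √r₁) := by
      linear_combination e3 + e4
    rw [h3]
    linarith
  have hp := Real.exp_pos (-(N * (√r₁ - √r₀) ^ 2))
  generalize Real.exp (-(N * (√r₁ - √r₀) ^ 2)) = e at *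
  have hq : √(1 - e) ≤ 1 - e / 2 := by
    apply Real.sqrt_le_iff.2
    constructor
    · linarith
    · nlinarith [sq_nonneg e]
  linarith
end

section
/- For every x ∈ (0,1] and every real N ≥ 1/2, one has exp(−Nx²) + exp(−4Nx) − 2·exp(−2Nx) > 0. -/
lemma g_aux (x : ℝ) (h0 : 0 < x) (h1 : x ≤ 1) :
    2 < Real.exp (x - x ^ 2 / 2) + Real.exp (-x) := by
  have hu : 0 ≤ x - x ^ 2 / 2 := by nlinarith
  have e1 := Real.sum_le_exp_of_nonneg hu 4
  have e2 := Real.exp_bound (x := -x) (by rw [abs_neg, abs_of_pos h0]; exact h1)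
    (n := 5) (by norm_num)
  rw [abs_neg, abs_of_pos h0] at e2
  have e3 := (abs_le.mp e2).1
  simp only [Finset.sum_range_succ, Finset.sum_range_zero] at e1 e3
  norm_num [Nat.factorial] at e1 e3
  have key : 0 < x ^ 2 * (1 / 2 - x / 2 - x ^ 2 / 12 + 23 / 200 * x ^ 3 - x ^ 4 / 48) := by
    apply mul_pos (by positivity)
    have hx2 : x ^ 2 ≤ 1 := by nlinarith
    have p3 : 0 < x ^ 3 := by positivity
    have a1 : 0 ≤ (1 - x) * x ^ 3 := mul_nonneg (by linarith) p3.le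
    have a2 : 0 ≤ (1 - x) * (1 - x ^ 2) := mul_nonneg (by linarith) (by linarith)
    nlinarith
  nlinarith

lemma g_conv (t c : ℝ) (h0 : 0 ≤ t) (h1 : t ≤ 1) :
    Real.exp (t * c) ≤ (1 - t) + t * Real.exp c := by
  have := convexOn_exp.2 (Set.mem_univ (0:ℝ)) (Set.mem_univ c) (sub_nonneg.2 h1) h0 (by ring)
  simpa using this

/-- For x ∈ (0,1] and N ≥ 1/2: exp(−Nx²) + exp(−4Nx) − 2exp(−2Nx) > 0. -/
theorem g_pos (x N : ℝ) (hx : x ∈ Set.Ioc (0:ℝ) 1) (hN : (1:ℝ) / 2 ≤ N) :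
    0 < Real.exp (-(N * x ^ 2)) + Real.exp (-(4 * N * x)) - 2 * Real.exp (-(2 * N * x)) := by
  obtain ⟨h0, h1⟩ := hx
  have hN0 : 0 < N := by linarith
  have ht0 : 0 < 1 / (2 * N) := by positivity
  have ht1 : 1 / (2 * N) ≤ 1 := by
    rw [div_le_one (by positivity)]; linarith
  have c1 := g_conv _ (N * (2 * x - x ^ 2)) ht0.le ht1
  have c2 := g_conv _ (-(2 * N * x)) ht0.le ht1
  have r1 : 1 / (2 * N) * (N * (2 * x - x ^ 2)) = x - x ^ 2 / 2 := by field_simp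
  have r2 : 1 / (2 * N) * (-(2 * N * x)) = -x := by field_simp
  rw [r1] at c1
  rw [r2] at c2
  have k := g_aux x h0 h1
  have hp : 0 < Real.exp (N * (2 * x - x ^ 2)) + Real.exp (-(2 * N * x)) - 2 := by
    refine pos_of_mul_pos_right (a := 1 / (2 * N)) ?_ ht0.le
    linarith
  have s1 : Real.exp (-(N * x ^ 2)) =
      Real.exp (-(2 * N * x)) * Real.exp (N * (2 * x - x ^ 2)) := by
    rw [← Real.exp_add]; ring_nf
  have s2 : Real.exp (-(4 * N * x)) =
      Real.exp (-(2 * N * x)) * Real.exp (-(2 * N * x)) := by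
    rw [← Real.exp_add]; ring_nf
  have := mul_pos (Real.exp_pos (-(2 * N * x))) hp
  rw [s1, s2]
  linarith
end

section
/- Let r₀ ∈ [0,1), set x := 1 − √r₀ ∈ (0,1], and let N ≥ 1/2 be a real number. Then there exists a real M̄ > 0 such that for every real M > M̄ one has (1/2)·(1 + Nx/M)^{−2M} < (1 − √(1 − exp(−Nx²)))/2. -/
theorem aux_exp_cubic (u : ℝ) (hu : 0 ≤ u) : 1 + u + u^2/2 + u^3/6 ≤ Real.exp u := by
  have h := Real.sum_le_exp_of_nonneg hu 4
  simp [Finset.sum_range_succ, Nat.factorial] at h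
  linarith

theorem aux_exp_neg (t : ℝ) (h0 : 0 ≤ t) (h1 : t ≤ 1) :
    1 - t + t^2/2 - t^3/6 + t^4/24 - t^5/100 ≤ Real.exp (-t) := by
  have h := Real.exp_bound (x := -t) (by rw [abs_neg, abs_of_nonneg h0]; exact h1)
    (n := 5) (by norm_num)
  rw [abs_neg, abs_of_nonneg h0] at h
  have h2 := (abs_le.mp h).1
  norm_num [Finset.sum_range_succ, Nat.factorial] at h2
  nlinarith [h2]

theorem aux_key (a x : ℝ) (ha : 0 < a) (hx1 : x ≤ 1) (hx2 : x ≤ 2 * a) :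
    2 < Real.exp (a * (2 - x)) + Real.exp (-(2 * a)) := by
  rcases le_total (1/2) a with h | h
  · have h1 : Real.exp a ≤ Real.exp (a * (2 - x)) := Real.exp_le_exp.mpr (by nlinarith)
    have h2 : (1.645:ℝ) ≤ Real.exp a := by
      have := aux_exp_cubic (1/2) (by norm_num)
      have h3 := Real.exp_le_exp.mpr h
      norm_num at this
      linarith
    have h3 : Real.exp a ^ 2 * Real.exp (-(2*a)) = 1 := by
      rw [sq, ← Real.exp_add, ← Real.exp_add]; ring_nf; simp
    set y := Real.exp a
    have h4 : 0 < y^2 * (y + Real.exp (-(2*a)) - 2) := by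
      have : y^2 * (y + Real.exp (-(2*a)) - 2) = (y-1)*(y^2-y-1) := by linear_combination h3
      rw [this]
      exact mul_pos (by linarith) (by nlinarith)
    have h5 := pos_of_mul_pos_right h4 (by positivity)
    linarith
  · obtain ⟨t, rfl⟩ : ∃ t, a = t / 2 := ⟨2 * a, by ring⟩
    have t0 : 0 < t := by linarith
    have t1 : t ≤ 1 := by linarith
    have h1 : Real.exp (t - t^2/2) ≤ Real.exp (t/2 * (2 - x)) :=
      Real.exp_le_exp.mpr (by nlinarith)
    have h2 := aux_exp_cubic (t - t^2/2) (by nlinarith)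
    have h3 := aux_exp_neg t t0.le t1
    have e : 2 * (t/2) = t := by ring
    rw [e]
    have h4 : 0 < 1/2 - t/2 - t^2/12 + 23*t^3/200 - t^4/48 := by
      obtain ⟨s, rfl⟩ : ∃ s, t = 1 - s := ⟨1 - t, by ring⟩
      have s0 : 0 ≤ s := by linarith
      have s1 : 0 ≤ 1 - s := by linarith
      nlinarith [mul_nonneg s0 s1, mul_nonneg (mul_nonneg s0 s0) s1,
        mul_nonneg (mul_nonneg s0 s0) (mul_nonneg s0 s1), mul_nonneg (mul_nonneg s0 s1) s1]
    have h5 := mul_pos (pow_pos t0 2) h4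
    nlinarith [h1, h2, h3, h5]

/-- Ideal-memory theorem (scalar skeleton): for r₀ ∈ [0,1), x := 1 − √r₀, and N ≥ 1/2,
there is Mbar > 0 such that for all M > Mbar the quantum Chernoff bound
(1/2)(1 + Nx/M)^{−2M} is strictly below the classical bound (1 − √(1 − exp(−Nx²)))/2. -/
theorem ideal_memory (r₀ : ℝ) (hr : r₀ ∈ Set.Ico (0:ℝ) 1) (N : ℝ) (hN : (1:ℝ) / 2 ≤ N) :
    ∃ Mbar : ℝ, 0 < Mbar ∧ ∀ M : ℝ, Mbar < M →
      (1 / 2) * (1 + N * (1 - Real.sqrt r₀) / M) ^ (-(2 * M)) <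
        (1 - Real.sqrt (1 - Real.exp (-(N * (1 - Real.sqrt r₀) ^ 2)))) / 2 := by
  have hx1 : 1 - Real.sqrt r₀ ≤ 1 := by linarith [Real.sqrt_nonneg r₀]
  have hx0 : 0 < 1 - Real.sqrt r₀ := by
    have : Real.sqrt r₀ < 1 := by
      rw [Real.sqrt_lt' one_pos]; simpa using hr.2
    linarith
  generalize 1 - Real.sqrt r₀ = x at *
  have ha : 0 < N * x := mul_pos (by linarith) hx0
  have key := aux_key (N * x) x ha hx1 (by nlinarith)
  have hlim : Real.exp (-(2 * (N * x))) < 1 - Real.sqrt (1 - Real.exp (-(N * x ^ 2))) := by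
    have hq0 := Real.exp_pos (-(2 * (N * x)))
    have hq1 : Real.exp (-(2 * (N * x))) < 1 := Real.exp_lt_one_iff.mpr (by linarith)
    have e : Real.exp (-(N * x ^ 2)) = Real.exp (N * x * (2 - x)) * Real.exp (-(2 * (N * x))) := by
      rw [← Real.exp_add]; congr 1; ring
    have : Real.sqrt (1 - Real.exp (-(N * x ^ 2))) < 1 - Real.exp (-(2 * (N * x))) := by
      rw [Real.sqrt_lt' (by linarith), e]
      nlinarith [mul_pos hq0 (sub_pos.mpr key)]
    linarith
  have ht := ((Real.tendsto_one_add_div_rpow_exp (N * x)).pow 2).inv₀ (by positivity)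
  have e2 : (Real.exp (N * x) ^ 2)⁻¹ = Real.exp (-(2 * (N * x))) := by
    rw [Real.exp_neg, ← Real.exp_nat_mul]; norm_num
  rw [e2] at ht
  obtain ⟨B, hB⟩ := Filter.eventually_atTop.mp (ht.eventually_lt_const hlim)
  refine ⟨max B 1, by positivity, fun M hM => ?_⟩
  have hMB : B ≤ M := (le_max_left _ _).trans hM.le
  have hM0 : 0 < M := one_pos.trans_le ((le_max_right _ _).trans hM.le)
  have h := hB M hMB
  have hb : 0 ≤ 1 + N * x / M := by positivity
  have e3 : (1 + N * x / M) ^ (-(2 * M)) = (((1 + N * x / M) ^ M) ^ 2)⁻¹ := by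
    rw [Real.rpow_neg hb, mul_comm 2 M, Real.rpow_mul hb]; norm_num
  rw [e3]
  linarith
end
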